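/- arXiv:1202.3066 — 2 statements merged into one kernel-verified Lean document; each statement's English description precedes it below -/
import Mathlib

section
/- Assume r ≥ 2 and that d ≥ 3 is odd. Let t be a positive integer with 2t < 3d, and let f be a nonzero homogeneous polynomial of degree d in x_0,…,x_r over K with sr(f) = t. Let A ∈ S(f) and suppose there are two distinct lines L_1 = ℙ(W_1), L_2 = ℙ(W_2) of ℙ^r with dim_K(W_1 ∩ W_2) = 1, such that #(A ∩ L_1) = #(A ∩ L_2) = (d+1)/2 and the point ℙ(W_1 ∩ W_2) is not a point of A. Then S(f) is infinite: there are infinitely many pairwise non-identified decompositions of f. -/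
open MvPolynomial

/-- The degree-`d` power of (a representative linear form of) a point of `ℙ^r`,
regarded as a homogeneous polynomial of degree `d` in `x_0, …, x_r`. -/
noncomputable def powForm (K : Type) [Field K] (r d : ℕ)
    (p : Projectivization K (Fin (r + 1) → K)) : MvPolynomial (Fin (r + 1)) K :=
  (∑ i, MvPolynomial.C (p.rep i) * MvPolynomial.X i) ^ d

/-- The span of the `d`-th powers of the linear forms corresponding to a set of
points of `ℙ^r`. -/
noncomputable def decompSpan (K : Type) [Field K] (r d : ℕ)
    (S : Set (Projectivization K (Fin (r + 1) → K))) :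
    Submodule K (MvPolynomial (Fin (r + 1)) K) :=
  Submodule.span K (powForm K r d '' S)

/-- The symmetric rank of `f`. -/
noncomputable def symRank (K : Type) [Field K] (r d : ℕ)
    (f : MvPolynomial (Fin (r + 1)) K) : ℕ :=
  sInf {n | ∃ A : Finset (Projectivization K (Fin (r + 1) → K)),
    A.card = n ∧ f ∈ decompSpan K r d ↑A}

/-- `S(f)`: the set of decompositions of `f`, i.e. finite sets of points of `ℙ^r`
computing the symmetric rank of `f`. -/
def decompSet (K : Type) [Field K] (r d : ℕ) (f : MvPolynomial (Fin (r + 1)) K) :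
    Set (Finset (Projectivization K (Fin (r + 1) → K))) :=
  {A | f ∈ decompSpan K r d ↑A ∧ A.card = symRank K r d f}

/-- The points of `ℙ^r` lying on the hypersurface `Z(q)`. -/
def projZeros (K : Type) [Field K] (r : ℕ) (q : MvPolynomial (Fin (r + 1)) K) :
    Set (Projectivization K (Fin (r + 1) → K)) :=
  {p | MvPolynomial.eval p.rep q = 0}

/-- A line of `ℙ^r`. -/
def IsProjLine (K : Type) [Field K] (r : ℕ)
    (L : Set (Projectivization K (Fin (r + 1) → K))) : Prop :=
  ∃ W : Submodule K (Fin (r + 1) → K), Module.finrank K W = 2 ∧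
    L = {p | p.rep ∈ W}

/-- A smooth conic of `ℙ^r`. -/
def IsSmoothConic (K : Type) [Field K] (r : ℕ)
    (C : Set (Projectivization K (Fin (r + 1) → K))) : Prop :=
  ∃ u v w : Fin (r + 1) → K, LinearIndependent K ![u, v, w] ∧
    C = {p | ∃ s t : K, (s ≠ 0 ∨ t ≠ 0) ∧
      p.submodule = Submodule.span K {s ^ 2 • u + (s * t) • v + t ^ 2 • w}}

/-- Roots of the pencil `nodal + c R` through the nodes: for all but finitely many `c` they are
simple, and they support the moments of `∑ αᵢ δ_{vᵢ}` with the top one shifted by `c`. -/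
theorem exists_moment_shift {K ι : Type*} [Field K] [IsAlgClosed K]
    (s : Finset ι) (v : ι → K) (hv : Set.InjOn v s) (hs : s.Nonempty)
    (α : ι → K) (hα : ∀ i ∈ s, α i ≠ 0) :
    ∃ (E : Set K) (Y : K → Finset K), E.Finite ∧ (∀ c c', c ≠ c' → Disjoint (Y c) (Y c')) ∧
      ∀ c ∉ E, (Y c).card = s.card ∧ ∃ β : K → K, ∀ k < 2 * s.card,
        ∑ i ∈ s, α i * v i ^ k + (if k + 1 = 2 * s.card then c else 0) =
          ∑ y ∈ Y c, β y * y ^ k := by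
  classical
  have hcard : 0 < s.card := hs.card_pos
  set Q := Lagrange.nodal s v with hQ
  set R := Lagrange.interpolate s v (fun i => -(Lagrange.nodalWeight s v i / α i)) with hR
  have hQm : Q.Monic := Lagrange.nodal_monic
  have hQd : Q.degree = s.card := Lagrange.degree_nodal
  have hRd : R.degree < s.card := Lagrange.degree_interpolate_lt _ hv
  have hRv : ∀ i ∈ s, R.eval (v i) = -(Lagrange.nodalWeight s v i / α i) :=
    fun i hi => Lagrange.eval_interpolate_at_node _ hv hi
  have hQv : ∀ i ∈ s, Q.eval (v i) = 0 := fun i hi => Lagrange.eval_nodal_at_node hi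
  have hRne : ∀ i ∈ s, R.eval (v i) ≠ 0 := fun i hi => by
    rw [hRv i hi]
    exact neg_ne_zero.2 (div_ne_zero (Lagrange.nodalWeight_ne_zero hv hi) (hα i hi))
  have hcop : ∀ x, Q.eval x = 0 → R.eval x ≠ 0 := by
    intro x hx
    rw [hQ, Lagrange.eval_nodal, Finset.prod_eq_zero_iff] at hx
    obtain ⟨i, hi, hxi⟩ := hx
    rw [sub_eq_zero.1 hxi]
    exact hRne i hi
  have hcRd : ∀ c : K, (Polynomial.C c * R).degree < Q.degree := fun c => by
    rw [hQd]
    rw [← Polynomial.smul_eq_C_mul]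
    exact lt_of_le_of_lt (Polynomial.degree_smul_le c R) hRd
  have hPm : ∀ c : K, (Q + Polynomial.C c * R).Monic := fun c => hQm.add_of_left (hcRd c)
  have hPd : ∀ c : K, (Q + Polynomial.C c * R).degree = s.card := fun c => by
    rw [Polynomial.degree_add_eq_left_of_degree_lt (hcRd c), hQd]
  have hPn : ∀ c : K, (Q + Polynomial.C c * R).natDegree = s.card := fun c =>
    Polynomial.natDegree_eq_of_degree_eq_some (hPd c)
  set D := Polynomial.derivative Q * R - Q * Polynomial.derivative R with hD
  have hD0 : D ≠ 0 := by
    obtain ⟨i, hi⟩ := hs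
    intro h
    have h1 : D.eval (v i) = 0 := by rw [h, Polynomial.eval_zero]
    rw [hD, Polynomial.eval_sub, Polynomial.eval_mul, Polynomial.eval_mul, hQv i hi, zero_mul,
      sub_zero] at h1
    rcases mul_eq_zero.1 h1 with h2 | h2
    · have := Lagrange.nodalWeight_ne_zero hv hi
      rw [Lagrange.nodalWeight_eq_eval_derivative_nodal hi, ← hQ, h2, inv_zero] at this
      exact this rfl
    · exact hRne i hi h2
  refine ⟨(fun x => -(Q.eval x / R.eval x)) '' (D.roots.toFinset : Set K),
    fun c => (Q + Polynomial.C c * R).roots.toFinset, (Finset.finite_toSet _).image _, ?_, ?_⟩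
  · intro c c' hcc
    rw [Finset.disjoint_left]
    intro x hx hx'
    rw [Multiset.mem_toFinset, Polynomial.mem_roots (hPm _).ne_zero, Polynomial.IsRoot.def,
      Polynomial.eval_add, Polynomial.eval_mul, Polynomial.eval_C] at hx hx'
    have h1 : (c - c') * R.eval x = 0 := by linear_combination hx - hx'
    have h2 : R.eval x = 0 := (mul_eq_zero.1 h1).resolve_left (sub_ne_zero.2 hcc)
    rw [h2, mul_zero, add_zero] at hx
    exact hcop x hx h2
  · intro c hc
    set P := Q + Polynomial.C c * R with hP
    have hnodup : P.roots.Nodup := by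
      rw [Multiset.nodup_iff_count_le_one]
      intro x
      by_contra! hx
      rw [Polynomial.count_roots, Polynomial.one_lt_rootMultiplicity_iff_isRoot (hPm c).ne_zero]
        at hx
      obtain ⟨hx1, hx2⟩ := hx
      simp only [Polynomial.IsRoot.def, Polynomial.derivative_add, Polynomial.derivative_mul,
        Polynomial.derivative_C, zero_mul, zero_add, Polynomial.eval_add, Polynomial.eval_mul,
        Polynomial.eval_C] at hx1 hx2
      have hRx : R.eval x ≠ 0 := by
        intro h
        rw [h, mul_zero, add_zero] at hx1
        exact hcop x hx1 h
      refine hc ⟨x, ?_, ?_⟩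
      · rw [Finset.mem_coe, Multiset.mem_toFinset, Polynomial.mem_roots hD0,
          Polynomial.IsRoot.def, hD, Polynomial.eval_sub, Polynomial.eval_mul, Polynomial.eval_mul]
        linear_combination R.eval x * hx2 - (Polynomial.derivative R).eval x * hx1
      · change -(Q.eval x / R.eval x) = c
        field_simp
        linear_combination -hx1
    have hYc : P.roots.toFinset.card = s.card := by
      rw [Multiset.toFinset_card_of_nodup hnodup, IsAlgClosed.card_roots_eq_natDegree, hPn]
    refine ⟨hYc, ?_⟩
    set T := P.roots.toFinset with hT
    set Λ : Polynomial K →ₗ[K] K :=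
      ∑ i ∈ s, α i • Polynomial.leval (v i) + c • Polynomial.lcoeff K (2 * s.card - 1) with hΛ
    have hΛa : ∀ p, Λ p = ∑ i ∈ s, α i * p.eval (v i) + c * p.coeff (2 * s.card - 1) := by
      intro p
      simp [hΛ, LinearMap.sum_apply, Polynomial.leval_apply]
    have horth : ∀ h : Polynomial K, h.degree < s.card → Λ (P * h) = 0 := by
      intro h hh
      have hhn : h.natDegree ≤ s.card - 1 := by
        rcases eq_or_ne h 0 with rfl | h0
        · simp
        · rw [Polynomial.degree_eq_natDegree h0, Nat.cast_lt] at hh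
          omega
      have hco : (P * h).coeff (2 * s.card - 1) = h.coeff (s.card - 1) := by
        have e : 2 * s.card - 1 = s.card + (s.card - 1) := by omega
        rw [e, Polynomial.coeff_mul_add_eq_of_natDegree_le (hPn c).le hhn]
        have := (hPm c).coeff_natDegree
        rw [hPn] at this
        rw [this, one_mul]
      rw [hΛa, hco, Lagrange.coeff_eq_sum hv hh, Finset.mul_sum, ← Finset.sum_add_distrib]
      refine Finset.sum_eq_zero fun i hi => ?_
      rw [hP, Polynomial.eval_mul, Polynomial.eval_add, Polynomial.eval_mul, Polynomial.eval_C,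
        hQv i hi, hRv i hi, Lagrange.nodalWeight, Finset.prod_inv_distrib]
      have := hα i hi
      field_simp
      ring
    refine ⟨fun y => Λ (Lagrange.basis T id y), fun k hk => ?_⟩
    have hdiv := Polynomial.modByMonic_add_div (Polynomial.X ^ k : Polynomial K) P
    have hdd : ((Polynomial.X ^ k : Polynomial K) /ₘ P).degree < s.card := by
      refine lt_of_le_of_lt Polynomial.degree_le_natDegree ?_
      rw [Polynomial.natDegree_divByMonic _ (hPm c), hPn, Polynomial.natDegree_X_pow, Nat.cast_lt]
      omega
    have hrd : ((Polynomial.X ^ k : Polynomial K) %ₘ P).degree < T.card := by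
      rw [hYc, ← hPd c]
      exact Polynomial.degree_modByMonic_lt _ (hPm c)
    have hrv : ∀ y ∈ T, ((Polynomial.X ^ k : Polynomial K) %ₘ P).eval (id y) = y ^ k := by
      intro y hy
      rw [hT, Multiset.mem_toFinset, Polynomial.mem_roots (hPm c).ne_zero] at hy
      have := congrArg (Polynomial.eval y) hdiv
      rw [Polynomial.eval_add, Polynomial.eval_mul, hy.eq_zero, zero_mul, add_zero] at this
      simpa using this
    have hint := Lagrange.eq_interpolate_of_eval_eq (fun y => y ^ k)
      (Function.injective_id.injOn) hrd hrv
    have h1 : Λ (Polynomial.X ^ k) = ∑ y ∈ T, Λ (Lagrange.basis T id y) * y ^ k := by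
      rw [← hdiv, map_add, horth _ hdd, add_zero, hint, Lagrange.interpolate_apply, map_sum]
      refine Finset.sum_congr rfl fun y _ => ?_
      rw [← Polynomial.smul_eq_C_mul, map_smul, smul_eq_mul, mul_comm]
    rw [← h1, hΛa]
    congr 1
    · simp
    · rw [Polynomial.coeff_X_pow, mul_ite, mul_one, mul_zero]
      exact if_congr (by omega) rfl rfl

/-- Binomial expansion of a combination of `d`-th powers, with the moments as coefficients. -/
theorem sum_smul_add_pow {K R ι : Type*} [Field K] [CommRing R] [Algebra K R] (d : ℕ)
    (o w : R) (s : Finset ι) (v α : ι → K) :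
    ∑ i ∈ s, α i • (v i • o + w) ^ d = ∑ k ∈ Finset.range (d + 1),
      (∑ i ∈ s, α i * v i ^ k) • (o ^ k * w ^ (d - k) * (d.choose k : R)) := by
  simp_rw [add_pow, Finset.smul_sum, Finset.sum_smul]
  rw [Finset.sum_comm]
  refine Finset.sum_congr rfl fun k _ => Finset.sum_congr rfl fun i _ => ?_
  rw [smul_pow, smul_mul_assoc, smul_mul_assoc, smul_smul]

/-- Equality of moments up to order `d` gives equality of the corresponding combinations of
`d`-th powers of the forms `y • o + w`. -/
theorem sum_pow_eq_of_moments {K R ι κ : Type*} [Field K] [CommRing R] [Algebra K R] (d : ℕ)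
    (o w : R) (s : Finset ι) (v α : ι → K) (T : Finset κ) (u β : κ → K) (c : K)
    (h : ∀ k < d + 1, ∑ i ∈ s, α i * v i ^ k + (if k = d then c else 0) =
      ∑ y ∈ T, β y * u y ^ k) :
    ∑ i ∈ s, α i • (v i • o + w) ^ d + c • o ^ d = ∑ y ∈ T, β y • (u y • o + w) ^ d := by
  have hc : c • o ^ d = ∑ k ∈ Finset.range (d + 1),
      (if k = d then c else 0) • (o ^ k * w ^ (d - k) * (d.choose k : R)) := by
    rw [Finset.sum_eq_single d]
    · simp
    · intro k _ hk
      simp [hk]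
    · simp
  rw [sum_smul_add_pow, hc, sum_smul_add_pow, ← Finset.sum_add_distrib]
  refine Finset.sum_congr rfl fun k hk => ?_
  rw [← add_smul, h k (Finset.mem_range.1 hk)]

/-- The linear form with coefficient vector `v`. -/
noncomputable def linForm (K : Type) [Field K] (r : ℕ) :
    (Fin (r + 1) → K) →ₗ[K] MvPolynomial (Fin (r + 1)) K where
  toFun v := ∑ i, MvPolynomial.C (v i) * MvPolynomial.X i
  map_add' v w := by simp [add_mul, Finset.sum_add_distrib]
  map_smul' a v := by simp [MvPolynomial.smul_eq_C_mul, Finset.mul_sum, mul_assoc]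

/-- `powForm` at a point is the `d`-th power of the linear form of its representative. -/
theorem powForm_eq_linForm_pow {K : Type} [Field K] {r d : ℕ}
    (p : Projectivization K (Fin (r + 1) → K)) : powForm K r d p = linForm K r p.rep ^ d := rfl

/-- A point of a projective line other than a given point `o` is represented by `y • o + w` for a
fixed vector `w` outside `K ∙ o`. -/
theorem exists_affine_chart {K V : Type*} [Field K] [AddCommGroup V] [Module K V]
    (W : Submodule K V) (hW : Module.finrank K W = 2) (o : V) (hoW : o ∈ W) (ho : o ≠ 0) :
    ∃ w ∈ W, w ∉ Submodule.span K {o} ∧ ∀ p ∈ W, p ∉ Submodule.span K {o} →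
      ∃ a x : K, a ≠ 0 ∧ p = a • (x • o + w) := by
  have : FiniteDimensional K W := FiniteDimensional.of_finrank_pos (by omega)
  have hle : Submodule.span K {o} ≤ W := (Submodule.span_singleton_le_iff_mem _ _).2 hoW
  obtain ⟨w, hwW, hwo⟩ : ∃ w ∈ W, w ∉ Submodule.span K {o} := by
    by_contra! h
    have h1 : W = Submodule.span K {o} := le_antisymm h hle
    rw [h1, finrank_span_singleton ho] at hW
    omega
  have hli : LinearIndependent K ![o, w] := by
    rw [LinearIndependent.pair_iff' ho]
    intro a ha
    exact hwo (Submodule.mem_span_singleton.2 ⟨a, ha⟩)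
  have hspan : Submodule.span K {o, w} = W := by
    refine Submodule.eq_of_le_of_finrank_eq ?_ ?_
    · rw [Submodule.span_le]
      rintro x (rfl | rfl)
      · exact hoW
      · exact hwW
    · have := finrank_span_eq_card hli
      rw [hW]
      rwa [Matrix.range_cons_cons_empty, Fintype.card_fin] at this
  refine ⟨w, hwW, hwo, fun p hp hpo => ?_⟩
  rw [← hspan, Submodule.mem_span_pair] at hp
  obtain ⟨b, a, rfl⟩ := hp
  have ha : a ≠ 0 := by
    rintro rfl
    exact hpo (Submodule.mem_span_singleton.2 ⟨b, by simp⟩)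
  refine ⟨a, a⁻¹ * b, ha, ?_⟩
  rw [smul_add, smul_smul, mul_inv_cancel_left₀ ha]

/-- Perturbing a sum of `m` powers of forms on a line by a multiple of `o ^ (2m-1)`: for all but
finitely many multiples the result is again a combination of `m` powers, and the supports are
pairwise disjoint. -/
theorem exists_line_family {K : Type} [Field K] [IsAlgClosed K] {r d : ℕ}
    (W : Submodule K (Fin (r + 1) → K)) (hW : Module.finrank K W = 2)
    (o : Fin (r + 1) → K) (hoW : o ∈ W) (ho : o ≠ 0)
    (s : Finset (Projectivization K (Fin (r + 1) → K))) (hs : s.Nonempty)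
    (hd : d + 1 = 2 * s.card)
    (hsW : ∀ p ∈ s, p.rep ∈ W) (hso : ∀ p ∈ s, p.rep ∉ Submodule.span K {o})
    (α : Projectivization K (Fin (r + 1) → K) → K) (hα : ∀ p ∈ s, α p ≠ 0) :
    ∃ (E : Set K) (B : K → Finset (Projectivization K (Fin (r + 1) → K))), E.Finite ∧
      (∀ c c', c ≠ c' → Disjoint (B c) (B c')) ∧
      (∀ c, ∀ p ∈ B c, p.rep ∈ W ∧ p.rep ∉ Submodule.span K {o}) ∧
      ∀ c ∉ E, (B c).card = s.card ∧
        ∑ p ∈ s, α p • powForm K r d p + c • linForm K r o ^ d ∈ decompSpan K r d (B c) := by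
  classical
  obtain ⟨w, hwW, hwo, hchart⟩ := exists_affine_chart W hW o hoW ho
  have hch : ∀ p : Projectivization K (Fin (r + 1) → K), ∃ a x : K,
      p ∈ s → a ≠ 0 ∧ p.rep = a • (x • o + w) := by
    intro p
    by_cases hp : p ∈ s
    · obtain ⟨a, x, h⟩ := hchart p.rep (hsW p hp) (hso p hp)
      exact ⟨a, x, fun _ => h⟩
    · exact ⟨0, 0, fun h => absurd h hp⟩
  choose a x hax using hch
  have hx : Set.InjOn x s := by
    intro p hp q hq hpq
    obtain ⟨ha, hp'⟩ := hax p hp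
    obtain ⟨hb, hq'⟩ := hax q hq
    rw [← p.mk_rep, ← q.mk_rep, Projectivization.mk_eq_mk_iff']
    refine ⟨a p * (a q)⁻¹, ?_⟩
    rw [hp', hq', hpq, smul_smul, mul_assoc, inv_mul_cancel₀ hb, mul_one]
  have hyo : ∀ y : K, y • o + w ∉ Submodule.span K {o} := fun y h => hwo <|
    (Submodule.add_mem_iff_right _
      (Submodule.smul_mem _ y (Submodule.mem_span_singleton_self o))).1 h
  have hy0 : ∀ y : K, y • o + w ≠ 0 := fun y h => hyo y (h ▸ Submodule.zero_mem _)
  have hinj : Function.Injective fun y : K =>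
      Projectivization.mk K (y • o + w) (hy0 y) := by
    intro y z h
    obtain ⟨b, hb⟩ := (Projectivization.mk_eq_mk_iff' K _ _ _ _).1 h
    by_contra hyz
    have hb1 : b = 1 := by
      by_contra hb1
      have h1 : (1 - b) • w = (b * z - y) • o := by
        have : b • (z • o + w) - (y • o + w) = 0 := by rw [hb, sub_self]
        rw [smul_add, smul_smul] at this
        rw [sub_smul, sub_smul, one_smul, ← sub_eq_zero, ← neg_eq_zero, ← this]
        abel
      refine hwo (Submodule.mem_span_singleton.2 ⟨(1 - b)⁻¹ * (b * z - y), ?_⟩)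
      rw [mul_smul, ← h1, inv_smul_smul₀ (sub_ne_zero.2 (Ne.symm hb1))]
    rw [hb1, one_smul, add_left_inj] at hb
    exact hyz (smul_left_injective K ho hb).symm
  obtain ⟨E, Y, hE, hY, hYE⟩ := exists_moment_shift s x hx hs (fun p => α p * a p ^ d)
    (fun p hp => mul_ne_zero (hα p hp) (pow_ne_zero _ (hax p hp).1))
  refine ⟨E, fun c => (Y c).map ⟨_, hinj⟩, hE, ?_, ?_, ?_⟩
  · intro c c' hcc
    exact (Finset.disjoint_map _).2 (hY c c' hcc)
  · intro c p hp
    obtain ⟨y, -, rfl⟩ := Finset.mem_map.1 hp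
    obtain ⟨b, hb⟩ := Projectivization.exists_smul_eq_mk_rep K _ (hy0 y)
    change (Projectivization.mk K (y • o + w) (hy0 y)).rep ∈ W ∧
      (Projectivization.mk K (y • o + w) (hy0 y)).rep ∉ Submodule.span K {o}
    rw [← hb]
    refine ⟨Submodule.smul_mem _ _ (W.add_mem (W.smul_mem _ hoW) hwW), fun h => hyo y ?_⟩
    exact (Submodule.smul_mem_iff _ b.ne_zero).1 h
  · intro c hc
    obtain ⟨hcard, β, hβ⟩ := hYE c hc
    refine ⟨by rw [Finset.card_map, hcard], ?_⟩
    have h1 : ∑ p ∈ s, α p • powForm K r d p =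
        ∑ p ∈ s, (α p * a p ^ d) • (x p • linForm K r o + linForm K r w) ^ d := by
      refine Finset.sum_congr rfl fun p hp => ?_
      rw [powForm_eq_linForm_pow, (hax p hp).2, map_smul, map_add, map_smul, smul_pow, smul_smul]
    rw [h1, sum_pow_eq_of_moments d _ _ s x _ (Y c) id β c]
    · refine Submodule.sum_mem _ fun y hy => Submodule.smul_mem _ _ ?_
      obtain ⟨b, hb⟩ := Projectivization.exists_smul_eq_mk_rep K _ (hy0 y)
      have hmem : powForm K r d (Projectivization.mk K (y • o + w) (hy0 y)) ∈
          decompSpan K r d ↑((Y c).map ⟨_, hinj⟩) :=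
        Submodule.subset_span ⟨_, Finset.mem_coe.2 (Finset.mem_map.2 ⟨y, hy, rfl⟩), rfl⟩
      rw [powForm_eq_linForm_pow, ← hb, Units.smul_def, map_smul, map_add, map_smul, smul_pow]
        at hmem
      exact (Submodule.smul_mem_iff _ (pow_ne_zero _ b.ne_zero)).1 hmem
    · intro k hk
      rw [← hd] at hβ
      have := hβ k hk
      simpa only [add_left_inj, id] using this

/-- In a minimal decomposition all coefficients are nonzero. -/
theorem exists_coeff_of_mem_decompSet {K : Type} [Field K] {r d : ℕ}
    {f : MvPolynomial (Fin (r + 1)) K} {A : Finset (Projectivization K (Fin (r + 1) → K))}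
    (hA : A ∈ decompSet K r d f) :
    ∃ α : Projectivization K (Fin (r + 1) → K) → K,
      f = ∑ p ∈ A, α p • powForm K r d p ∧ ∀ p ∈ A, α p ≠ 0 := by
  classical
  obtain ⟨hf, hcard⟩ := hA
  obtain ⟨α, hα⟩ := Submodule.mem_span_image_finset_iff_exists_fun' K |>.1 hf
  refine ⟨α, hα.symm, fun p hp h0 => ?_⟩
  have hmem : f ∈ decompSpan K r d ↑(A.erase p) := by
    rw [← hα, ← Finset.add_sum_erase _ _ hp, h0, zero_smul, zero_add]
    exact Submodule.sum_mem _ fun q hq => Submodule.smul_mem _ _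
      (Submodule.subset_span ⟨q, Finset.mem_coe.2 hq, rfl⟩)
  have hle : symRank K r d f ≤ (A.erase p).card := Nat.sInf_le ⟨_, rfl, hmem⟩
  rw [← hcard, Finset.card_erase_of_mem hp] at hle
  have := Finset.card_pos.2 ⟨p, hp⟩
  omega

/-- case (c): `d` odd, `A ∈ S(f)` meeting each of two distinct
intersecting lines `L₁ = ℙ(W₁)`, `L₂ = ℙ(W₂)` in exactly `(d+1)/2` points, with
the intersection point of the two lines not in `A`; then `S(f)` is infinite. -/
theorem stmt_14 {K : Type} [Field K] [IsAlgClosed K] [CharZero K]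
    {r d t : ℕ} (hr : 2 ≤ r) (hd : 3 ≤ d) (hodd : Odd d)
    (ht : 0 < t) (htd : 2 * t < 3 * d)
    {f : MvPolynomial (Fin (r + 1)) K} (hf0 : f ≠ 0) (hfh : f.IsHomogeneous d)
    (hsr : symRank K r d f = t)
    {A : Finset (Projectivization K (Fin (r + 1) → K))}
    (hA : A ∈ decompSet K r d f)
    {W₁ W₂ : Submodule K (Fin (r + 1) → K)}
    (hW₁ : Module.finrank K W₁ = 2) (hW₂ : Module.finrank K W₂ = 2)
    (hne : W₁ ≠ W₂) (hmeet : Module.finrank K ↥(W₁ ⊓ W₂) = 1)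
    (hc₁ : ((↑A : Set (Projectivization K (Fin (r + 1) → K)))
      ∩ {p | p.rep ∈ W₁}).ncard = (d + 1) / 2)
    (hc₂ : ((↑A : Set (Projectivization K (Fin (r + 1) → K)))
      ∩ {p | p.rep ∈ W₂}).ncard = (d + 1) / 2)
    (hO : ∀ p ∈ A, p.rep ∉ W₁ ⊓ W₂) :
    (decompSet K r d f).Infinite := by
  classical
  obtain ⟨m, hm⟩ := hodd
  obtain ⟨α, hfα, hα⟩ := exists_coeff_of_mem_decompSet hA
  obtain ⟨⟨o, hoW⟩, ho, hospan⟩ := finrank_eq_one_iff'.1 hmeet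
  have ho : o ≠ 0 := fun h => ho (Subtype.ext h)
  have hinf : ∀ u, u ∈ W₁ → u ∈ W₂ → u ∈ Submodule.span K {o} := fun u h1 h2 => by
    obtain ⟨b, hb⟩ := hospan ⟨u, h1, h2⟩
    exact Submodule.mem_span_singleton.2 ⟨b, congrArg Subtype.val hb⟩
  have hspan_le : Submodule.span K {o} ≤ W₁ ⊓ W₂ :=
    (Submodule.span_singleton_le_iff_mem _ _).2 hoW
  have hAo : ∀ p ∈ A, p.rep ∉ Submodule.span K {o} := fun p hp h => hO p hp (hspan_le h)
  set A₁ := A.filter (fun p => p.rep ∈ W₁) with hA₁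
  set A₂ := A.filter (fun p => p.rep ∉ W₁ ∧ p.rep ∈ W₂) with hA₂
  set A₃ := A.filter (fun p => p.rep ∉ W₁ ∧ p.rep ∉ W₂) with hA₃
  have hA₂' : A₂ = A.filter (fun p => p.rep ∈ W₂) := by
    refine Finset.filter_congr fun p hp => ⟨fun h => h.2, fun h => ⟨fun h' => ?_, h⟩⟩
    exact hO p hp ⟨h', h⟩
  have card₁ : A₁.card = m + 1 := by
    rw [← Set.ncard_coe_finset, hA₁, Finset.coe_filter]
    refine Eq.trans ?_ (hc₁.trans (by omega))
    rfl
  have card₂ : A₂.card = m + 1 := by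
    rw [← Set.ncard_coe_finset, hA₂', Finset.coe_filter]
    refine Eq.trans ?_ (hc₂.trans (by omega))
    rfl
  have hsplit : ∀ {M : Type} [AddCommMonoid M]
      (g : Projectivization K (Fin (r + 1) → K) → M),
      ∑ p ∈ A, g p = ∑ p ∈ A₁, g p + (∑ p ∈ A₂, g p + ∑ p ∈ A₃, g p) := by
    intro M _ g
    rw [← Finset.sum_filter_add_sum_filter_not A (fun p => p.rep ∈ W₁),
      ← Finset.sum_filter_add_sum_filter_not (A.filter (fun p => p.rep ∉ W₁))
        (fun p => p.rep ∈ W₂), Finset.filter_filter, Finset.filter_filter]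
  have hcardA : A.card = A₁.card + (A₂.card + A₃.card) := by
    simpa only [Finset.card_eq_sum_ones] using hsplit (fun _ => (1 : ℕ))
  have sub : ∀ {P : Projectivization K (Fin (r + 1) → K) → Prop} [DecidablePred P] {p},
      p ∈ A.filter P → p ∈ A := fun h => (Finset.mem_filter.1 h).1
  obtain ⟨E₁, B₁, hE₁, hdis, hB₁, hB₁E⟩ := exists_line_family (d := d) W₁ hW₁ o hoW.1 ho A₁
    (Finset.card_pos.1 (by omega)) (by omega) (fun p hp => (Finset.mem_filter.1 hp).2)
    (fun p hp => hAo p (sub hp)) α (fun p hp => hα p (sub hp))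
  obtain ⟨E₂, B₂, hE₂, -, hB₂, hB₂E⟩ := exists_line_family (d := d) W₂ hW₂ o hoW.2 ho A₂
    (Finset.card_pos.1 (by omega)) (by omega) (fun p hp => (Finset.mem_filter.1 hp).2.2)
    (fun p hp => hAo p (sub hp)) α (fun p hp => hα p (sub hp))
  have hE : (E₁ ∪ Neg.neg ⁻¹' E₂).Finite :=
    hE₁.union (hE₂.preimage neg_injective.injOn)
  refine Set.infinite_of_injOn_mapsTo (s := (E₁ ∪ Neg.neg ⁻¹' E₂)ᶜ)
    (f := fun c => B₁ c ∪ (B₂ (-c) ∪ A₃)) ?_ ?_ hE.infinite_compl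
  · intro c hc c' hc' h
    by_contra hcc
    rw [Set.mem_compl_iff, Set.mem_union, not_or] at hc
    have hne : (B₁ c).Nonempty := Finset.card_pos.1 (by rw [(hB₁E c hc.1).1]; omega)
    obtain ⟨p, hp⟩ := hne
    have hpW := hB₁ c p hp
    have hp' : p ∈ B₁ c' ∪ (B₂ (-c') ∪ A₃) := by
      rw [← show B₁ c ∪ (B₂ (-c) ∪ A₃) = B₁ c' ∪ (B₂ (-c') ∪ A₃) from h]
      exact Finset.mem_union_left _ hp
    rw [Finset.mem_union, Finset.mem_union] at hp'
    rcases hp' with h1 | h1 | h1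
    · exact Finset.disjoint_left.1 (hdis c c' hcc) hp h1
    · exact hpW.2 (hinf _ hpW.1 (hB₂ _ p h1).1)
    · exact (Finset.mem_filter.1 h1).2.1 hpW.1
  · intro c hc
    rw [Set.mem_compl_iff, Set.mem_union, not_or] at hc
    obtain ⟨hcard1, hmem1⟩ := hB₁E c hc.1
    obtain ⟨hcard2, hmem2⟩ := hB₂E (-c) hc.2
    have mono : ∀ {S T : Finset (Projectivization K (Fin (r + 1) → K))}, S ⊆ T →
        decompSpan K r d ↑S ≤ decompSpan K r d ↑T := fun h =>
      Submodule.span_mono (Set.image_mono (Finset.coe_subset.2 h))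
    have hmem : f ∈ decompSpan K r d ↑(B₁ c ∪ (B₂ (-c) ∪ A₃)) := by
      have e : f = (∑ p ∈ A₁, α p • powForm K r d p + c • linForm K r o ^ d) +
          ((∑ p ∈ A₂, α p • powForm K r d p + (-c) • linForm K r o ^ d) +
            ∑ p ∈ A₃, α p • powForm K r d p) := by
        rw [hfα, hsplit, neg_smul]
        abel
      rw [e]
      refine Submodule.add_mem _ (mono Finset.subset_union_left hmem1)
        (mono Finset.subset_union_right (Submodule.add_mem _
          (mono Finset.subset_union_left hmem2) (mono Finset.subset_union_right ?_)))
      exact Submodule.sum_mem _ fun q hq => Submodule.smul_mem _ _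
        (Submodule.subset_span ⟨q, Finset.mem_coe.2 hq, rfl⟩)
    refine ⟨hmem, le_antisymm ?_ (Nat.sInf_le ⟨_, rfl, hmem⟩)⟩
    rw [← hA.2, hcardA, ← hcard1, ← hcard2]
    exact (Finset.card_union_le _ _).trans (by gcongr; exact Finset.card_union_le _ _)
end

section
/- Assume r ≥ 2 and d ≥ 3. Let t be a positive integer with 2t < 3d, and let f be a nonzero homogeneous polynomial of degree d in x_0,…,x_r over K with sr(f) = t. Let A, B ∈ S(f) be two non-identified decompositions, and let T be a smooth conic of ℙ^r with #((A ∪ B) ∩ T) ≥ 2d + 2. Then A ∖ T = B ∖ T as sets of points of ℙ^r; moreover, setting F := A ∖ T and letting g be a generator of the one-dimensional subspace span{ℓ^d : ℓ ∈ A ∩ T} ∩ span({f} ∪ {ℓ^d : ℓ ∈ F}), one has sr(g) = #(A ∩ T) = #(B ∩ T) and B ∩ T is a decomposition of g. -/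
open MvPolynomial

/-- The linear form with the coefficients of the chosen representative of a point. -/
noncomputable def repForm (K : Type) [Field K] (r : ℕ)
    (p : Projectivization K (Fin (r + 1) → K)) : MvPolynomial (Fin (r + 1)) K :=
  ∑ i, MvPolynomial.C (p.rep i) * MvPolynomial.X i

section

variable {K : Type} [Field K] {r : ℕ}

lemma powForm_eq (d : ℕ) (p : Projectivization K (Fin (r + 1) → K)) :
    powForm K r d p = repForm K r p ^ d := rfl

lemma pderiv_repForm (p : Projectivization K (Fin (r + 1) → K)) (i : Fin (r + 1)) :
    pderiv i (repForm K r p) = C (p.rep i) := by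
  classical
  simp only [repForm, map_sum, Derivation.leibniz, pderiv_C, pderiv_X, smul_eq_mul, mul_zero,
    add_zero]
  rw [Finset.sum_eq_single i] <;> simp +contextual [eq_comm]

lemma repForm_ne_zero (p : Projectivization K (Fin (r + 1) → K)) : repForm K r p ≠ 0 := by
  intro h
  apply p.rep_nonzero
  ext i
  have := pderiv_repForm p i
  rw [h, map_zero] at this
  simpa using this.symm

/-- Differentiating a linear relation between powers of linear forms. -/
lemma sum_smul_repForm_pow_of_succ [CharZero K] {k : ℕ}
    {Z : Finset (Projectivization K (Fin (r + 1) → K))}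
    {c : Projectivization K (Fin (r + 1) → K) → K}
    (h : ∑ p ∈ Z, c p • repForm K r p ^ (k + 1) = 0) (L : Module.Dual K (Fin (r + 1) → K)) :
    ∑ p ∈ Z, (c p * L p.rep) • repForm K r p ^ k = 0 := by
  classical
  have key (i : Fin (r + 1)) : ∑ p ∈ Z, (c p * p.rep i) • repForm K r p ^ k = 0 := by
    have h1 := congrArg (pderiv i) h
    simp only [map_sum, map_zero, Derivation.map_smul, Derivation.leibniz_pow,
      pderiv_repForm, Nat.add_sub_cancel, smul_eq_mul] at h1
    have h2 : (k + 1 : K) • ∑ p ∈ Z, (c p * p.rep i) • repForm K r p ^ k = 0 := by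
      rw [← h1, Finset.smul_sum]
      refine Finset.sum_congr rfl fun p _ => ?_
      simp only [smul_eq_C_mul, nsmul_eq_mul, map_mul, map_add, map_natCast, map_one]
      push_cast
      ring
    exact (smul_eq_zero.mp h2).resolve_left (by exact_mod_cast k.succ_ne_zero)
  have hL (v : Fin (r + 1) → K) : L v = ∑ i, L (Pi.single i 1) * v i := by
    conv_lhs => rw [pi_eq_sum_univ' v]
    simp [map_sum, mul_comm]
  have : ∑ i, L (Pi.single i 1) • ∑ p ∈ Z, (c p * p.rep i) • repForm K r p ^ k = 0 := by
    simp [key]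
  rw [← this]
  simp only [Finset.smul_sum]
  rw [Finset.sum_comm]
  refine Finset.sum_congr rfl fun p _ => ?_
  rw [hL, Finset.mul_sum, Finset.sum_smul]
  refine Finset.sum_congr rfl fun i _ => ?_
  rw [smul_smul]
  ring_nf

lemma sum_smul_repForm_pow_prod [CharZero K] {ι : Type*} {k : ℕ}
    {Z : Finset (Projectivization K (Fin (r + 1) → K))} (s : Finset ι)
    (L : ι → Module.Dual K (Fin (r + 1) → K))
    {c : Projectivization K (Fin (r + 1) → K) → K}
    (h : ∑ p ∈ Z, c p • repForm K r p ^ (k + s.card) = 0) :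
    ∑ p ∈ Z, (c p * ∏ i ∈ s, L i p.rep) • repForm K r p ^ k = 0 := by
  classical
  induction s using Finset.induction_on generalizing c with
  | empty => simpa using h
  | insert a s ha ih =>
    rw [Finset.card_insert_of_notMem ha, ← add_assoc] at h
    have := ih (sum_smul_repForm_pow_of_succ h (L a))
    simpa only [Finset.prod_insert ha, mul_assoc] using this

/-- A linear form vanishing at one point and not at another. -/
lemma exists_dual_separating {p q : Projectivization K (Fin (r + 1) → K)} (hpq : p ≠ q) :
    ∃ L : Module.Dual K (Fin (r + 1) → K), L q.rep = 0 ∧ L p.rep ≠ 0 := by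
  have hp : p.rep ∉ K ∙ q.rep := by
    intro h
    obtain ⟨a, ha⟩ := Submodule.mem_span_singleton.mp h
    apply hpq
    rw [← p.mk_rep, ← q.mk_rep, Projectivization.mk_eq_mk_iff']
    exact ⟨a, ha⟩
  obtain ⟨L, hL, hL'⟩ := Submodule.exists_le_ker_of_notMem hp
  exact ⟨L, by simpa using hL' (Submodule.mem_span_singleton_self _), hL⟩

/-- A smooth conic is cut out by quadrics of the form `L₁ L₂ - L₃ L₄`. -/
lemma IsSmoothConic.exists_quadric [IsAlgClosed K]
    {T : Set (Projectivization K (Fin (r + 1) → K))} (hT : IsSmoothConic K r T)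
    {p : Projectivization K (Fin (r + 1) → K)} (hp : p ∉ T) :
    ∃ L₁ L₂ L₃ L₄ : Module.Dual K (Fin (r + 1) → K),
      (∀ q ∈ T, L₁ q.rep * L₂ q.rep - L₃ q.rep * L₄ q.rep = 0) ∧
      L₁ p.rep * L₂ p.rep - L₃ p.rep * L₄ p.rep ≠ 0 := by
  obtain ⟨u, v, w, hli, rfl⟩ := hT
  have hrep (q : Projectivization K (Fin (r + 1) → K)) (s t : K)
      (h : q.submodule = K ∙ (s ^ 2 • u + (s * t) • v + t ^ 2 • w)) :
      ∃ a : K, q.rep = a • (s ^ 2 • u + (s * t) • v + t ^ 2 • w) := by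
    have : q.rep ∈ q.submodule := by
      rw [Projectivization.submodule_eq]; exact Submodule.mem_span_singleton_self _
    rw [h] at this
    obtain ⟨a, ha⟩ := Submodule.mem_span_singleton.mp this
    exact ⟨a, ha.symm⟩
  by_cases hps : p.rep ∈ Submodule.span K (Set.range ![u, v, w])
  · have hdual (i : Fin 3) : ∃ L : Module.Dual K (Fin (r + 1) → K),
        ∀ j, L (![u, v, w] j) = if j = i then 1 else 0 := by
      obtain ⟨L, hL⟩ := LinearMap.exists_extend
        ((Finsupp.lapply i).comp hli.repr)
      refine ⟨L, fun j => ?_⟩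
      have h := LinearMap.congr_fun hL
        ⟨![u, v, w] j, Submodule.subset_span (Set.mem_range_self j)⟩
      simp only [LinearMap.comp_apply, Submodule.subtype_apply] at h
      rw [h, hli.repr_eq_single j ⟨![u, v, w] j,
        Submodule.subset_span (Set.mem_range_self j)⟩ rfl]
      simp [Finsupp.single_apply]
    obtain ⟨α, hα⟩ := hdual 0
    obtain ⟨β, hβ⟩ := hdual 1
    obtain ⟨γ, hγ⟩ := hdual 2
    simp [Fin.forall_fin_succ] at hα hβ hγ
    obtain ⟨hα0, hα1, hα2⟩ := hα
    obtain ⟨hβ0, hβ1, hβ2⟩ := hβ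
    obtain ⟨hγ0, hγ1, hγ2⟩ := hγ
    refine ⟨β, β, α, γ, ?_, ?_⟩
    · rintro q ⟨s, t, -, hq⟩
      obtain ⟨a, ha⟩ := hrep q s t hq
      simp only [ha, map_smul, map_add, smul_eq_mul, hα0, hα1, hα2, hβ0, hβ1, hβ2, hγ0, hγ1, hγ2]
      ring
    · intro hz
      apply hp
      obtain ⟨c, hc⟩ := (Submodule.mem_span_range_iff_exists_fun K).mp hps
      simp only [Fin.sum_univ_three, Matrix.cons_val] at hc
      generalize c 0 = a, c 1 = b, c 2 = e at hc
      simp only [← hc, map_smul, map_add, smul_eq_mul, hα0, hα1, hα2, hβ0, hβ1, hβ2,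
        hγ0, hγ1, hγ2, mul_zero, mul_one, add_zero, zero_add] at hz
      have hb : b * b = a * e := sub_eq_zero.mp hz
      have hne : a • u + b • v + e • w ≠ 0 := hc ▸ p.rep_nonzero
      suffices h : ∃ s t : K, s ^ 2 = a ∧ s * t = b ∧ t ^ 2 = e by
        obtain ⟨s, t, rfl, rfl, rfl⟩ := h
        refine ⟨s, t, ?_, by rw [Projectivization.submodule_eq, hc]⟩
        by_contra! h0
        exact hne (by simp [h0])
      obtain ⟨s, hs⟩ := IsAlgClosed.exists_pow_nat_eq a (n := 2) two_pos
      by_cases hs0 : s = 0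
      · obtain ⟨t, ht⟩ := IsAlgClosed.exists_pow_nat_eq e (n := 2) two_pos
        subst hs0
        have ha : a = 0 := by rw [← hs]; ring
        have hb0 : b = 0 := by simpa [ha] using hb
        exact ⟨0, t, hs, by simp [hb0], ht⟩
      · refine ⟨s, b / s, hs, by field_simp, ?_⟩
        rw [div_pow, hs, pow_two b, hb, mul_div_cancel_left₀]
        rw [← hs]; exact pow_ne_zero 2 hs0
  · obtain ⟨L, hL, hL'⟩ := Submodule.exists_le_ker_of_notMem hps
    refine ⟨L, L, 0, 0, ?_, by simpa using hL⟩
    rintro q ⟨s, t, -, hq⟩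
    obtain ⟨a, ha⟩ := hrep q s t hq
    have h (i : Fin 3) : L (![u, v, w] i) = 0 := by
      simpa using hL' (Submodule.subset_span (Set.mem_range_self i))
    have h0 : L u = 0 := h 0
    have h1 : L v = 0 := h 1
    have h2 : L w = 0 := h 2
    simp [ha, h0, h1, h2]

/-- If few points of `Z` lie off the smooth conic `T`, they do not occur in any linear relation
between the `d`-th powers of the linear forms in `Z`. -/
lemma IsSmoothConic.coeff_eq_zero [IsAlgClosed K] [CharZero K] {d : ℕ}
    {T : Set (Projectivization K (Fin (r + 1) → K))} (hT : IsSmoothConic K r T)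
    {Z : Finset (Projectivization K (Fin (r + 1) → K))}
    (hZ : ((Z : Set (Projectivization K (Fin (r + 1) → K))) \ T).ncard + 1 ≤ d)
    {c : Projectivization K (Fin (r + 1) → K) → K}
    (h : ∑ p ∈ Z, c p • powForm K r d p = 0)
    {p : Projectivization K (Fin (r + 1) → K)} (hpZ : p ∈ Z) (hpT : p ∉ T) : c p = 0 := by
  classical
  obtain ⟨L₁, L₂, L₃, L₄, hQ, hQp⟩ := hT.exists_quadric hpT
  set R := {q ∈ Z | q ∉ T}.erase p with hR
  have hcard : R.card + 2 ≤ d := by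
    have h1 : (Z : Set (Projectivization K (Fin (r + 1) → K))) \ T = ↑{q ∈ Z | q ∉ T} := by
      ext; simp
    rw [h1, Set.ncard_coe_finset] at hZ
    have h2 : p ∈ {q ∈ Z | q ∉ T} := by simp [hpZ, hpT]
    have h3 := Finset.card_erase_add_one h2
    rw [hR]
    omega
  obtain ⟨k, rfl⟩ := Nat.exists_eq_add_of_le hcard
  have hexp : R.card + 2 + k = (k + R.card) + 1 + 1 := by ring
  simp only [powForm_eq, hexp] at h
  have h12 := sum_smul_repForm_pow_of_succ (sum_smul_repForm_pow_of_succ h L₁) L₂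
  have h34 := sum_smul_repForm_pow_of_succ (sum_smul_repForm_pow_of_succ h L₃) L₄
  have hsub : ∑ q ∈ Z, (c q * (L₁ q.rep * L₂ q.rep - L₃ q.rep * L₄ q.rep)) •
      repForm K r q ^ (k + R.card) = 0 := by
    rw [← sub_zero (0 : MvPolynomial (Fin (r + 1)) K)]
    nth_rewrite 1 [← h12]
    rw [← h34, ← Finset.sum_sub_distrib]
    refine Finset.sum_congr rfl fun q _ => ?_
    rw [← sub_smul]
    ring_nf
  have hsep (q : Projectivization K (Fin (r + 1) → K)) :
      ∃ L : Module.Dual K (Fin (r + 1) → K), p ≠ q → L q.rep = 0 ∧ L p.rep ≠ 0 := by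
    by_cases hpq : p = q
    · exact ⟨0, fun h => absurd hpq h⟩
    · obtain ⟨L, hL⟩ := exists_dual_separating hpq
      exact ⟨L, fun _ => hL⟩
  choose M hM using hsep
  have hprod := sum_smul_repForm_pow_prod R M hsub
  rw [Finset.sum_eq_single_of_mem p hpZ] at hprod
  · have hMp : ∏ q ∈ R, M q p.rep ≠ 0 :=
      Finset.prod_ne_zero_iff.mpr fun q hq => (hM q (Finset.ne_of_mem_erase hq).symm).2
    have h0 := (smul_eq_zero.mp hprod).resolve_right (pow_ne_zero _ (repForm_ne_zero p))
    exact (mul_eq_zero.mp ((mul_eq_zero.mp h0).resolve_right hMp)).resolve_right hQp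
  · intro q hq hqp
    by_cases hqT : q ∈ T
    · simp [hQ q hqT]
    · have hqR : q ∈ R := by simp [hR, hq, hqT, hqp]
      rw [Finset.prod_eq_zero hqR (hM q (Ne.symm hqp)).1]
      simp

lemma mem_decompSpan_finset {d : ℕ} {A : Finset (Projectivization K (Fin (r + 1) → K))}
    {f : MvPolynomial (Fin (r + 1)) K} :
    f ∈ decompSpan K r d ↑A ↔ ∃ c : Projectivization K (Fin (r + 1) → K) → K,
      ∑ p ∈ A, c p • powForm K r d p = f :=
  Submodule.mem_span_image_finset_iff_exists_fun' K

lemma symRank_le_card {d : ℕ} {A : Finset (Projectivization K (Fin (r + 1) → K))}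
    {f : MvPolynomial (Fin (r + 1)) K} (h : f ∈ decompSpan K r d ↑A) :
    symRank K r d f ≤ A.card :=
  Nat.sInf_le ⟨A, rfl, h⟩

lemma exists_card_eq_symRank {d : ℕ} {A : Finset (Projectivization K (Fin (r + 1) → K))}
    {f : MvPolynomial (Fin (r + 1)) K} (h : f ∈ decompSpan K r d ↑A) :
    ∃ E : Finset (Projectivization K (Fin (r + 1) → K)),
      E.card = symRank K r d f ∧ f ∈ decompSpan K r d ↑E :=
  Nat.sInf_mem (s := {n | ∃ A : Finset (Projectivization K (Fin (r + 1) → K)),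
    A.card = n ∧ f ∈ decompSpan K r d ↑A}) ⟨A.card, A, rfl, h⟩

/-- Every coefficient of a minimal decomposition is nonzero. -/
lemma coeff_ne_zero_of_mem_decompSet {d : ℕ}
    {A : Finset (Projectivization K (Fin (r + 1) → K))} {f : MvPolynomial (Fin (r + 1)) K}
    (hA : A ∈ decompSet K r d f) {c : Projectivization K (Fin (r + 1) → K) → K}
    (hc : ∑ p ∈ A, c p • powForm K r d p = f)
    {p : Projectivization K (Fin (r + 1) → K)} (hp : p ∈ A) : c p ≠ 0 := by
  classical
  intro h0
  have hf : f ∈ decompSpan K r d ↑(A.erase p) := by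
    refine mem_decompSpan_finset.mpr ⟨c, ?_⟩
    rw [← hc, ← Finset.add_sum_erase A _ hp, h0, zero_smul, zero_add]
  have h1 := symRank_le_card hf
  have h2 := Finset.card_erase_lt_of_mem hp
  have h3 := hA.2
  omega

end

/-- two distinct decompositions `A, B ∈ S(f)` with
`#((A ∪ B) ∩ T) ≥ 2d + 2` for a smooth conic `T` agree off `T`; moreover, with
`F := A \ T`, the subspace `span{ℓ^d : A ∩ T} ∩ span({f} ∪ {ℓ^d : F})` is
one-dimensional and, for any generator `g` of it, `sr(g) = #(A ∩ T) = #(B ∩ T)`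
and `B ∩ T` is a decomposition of `g`. -/
theorem stmt_16 {K : Type} [Field K] [IsAlgClosed K] [CharZero K]
    {r d t : ℕ} (hr : 2 ≤ r) (hd : 3 ≤ d) (ht : 0 < t) (htd : 2 * t < 3 * d)
    {f : MvPolynomial (Fin (r + 1)) K} (hf0 : f ≠ 0) (hfh : f.IsHomogeneous d)
    (hsr : symRank K r d f = t)
    {A B : Finset (Projectivization K (Fin (r + 1) → K))}
    (hA : A ∈ decompSet K r d f) (hB : B ∈ decompSet K r d f) (hAB : A ≠ B)
    {T : Set (Projectivization K (Fin (r + 1) → K))} (hT : IsSmoothConic K r T)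
    (hcard : 2 * d + 2 ≤
      ((↑A ∪ ↑B : Set (Projectivization K (Fin (r + 1) → K))) ∩ T).ncard) :
    (↑A : Set (Projectivization K (Fin (r + 1) → K))) \ T = ↑B \ T
    ∧ Module.finrank K
        ↥(decompSpan K r d ((↑A : Set (Projectivization K (Fin (r + 1) → K))) ∩ T)
          ⊓ Submodule.span K ({f} ∪ powForm K r d ''
              ((↑A : Set (Projectivization K (Fin (r + 1) → K))) \ T))) = 1
    ∧ ∀ g : MvPolynomial (Fin (r + 1)) K, g ≠ 0 →
        g ∈ decompSpan K r d ((↑A : Set (Projectivization K (Fin (r + 1) → K))) ∩ T)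
          ⊓ Submodule.span K ({f} ∪ powForm K r d ''
              ((↑A : Set (Projectivization K (Fin (r + 1) → K))) \ T)) →
        symRank K r d g
            = ((↑A : Set (Projectivization K (Fin (r + 1) → K))) ∩ T).ncard
        ∧ ((↑A : Set (Projectivization K (Fin (r + 1) → K))) ∩ T).ncard
            = ((↑B : Set (Projectivization K (Fin (r + 1) → K))) ∩ T).ncard
        ∧ g ∈ decompSpan K r d
            ((↑B : Set (Projectivization K (Fin (r + 1) → K))) ∩ T)
        ∧ ((↑B : Set (Projectivization K (Fin (r + 1) → K))) ∩ T).ncard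
            = symRank K r d g := by
  classical
  obtain ⟨a, ha⟩ := mem_decompSpan_finset.mp hA.1
  obtain ⟨b, hb⟩ := mem_decompSpan_finset.mp hB.1
  have hAt : A.card = t := hA.2.trans hsr
  have hBt : B.card = t := hB.2.trans hsr
  have hZ : ((↑(A ∪ B) : Set (Projectivization K (Fin (r + 1) → K))) \ T).ncard + 1 ≤ d := by
    have h1 := Set.ncard_inter_add_ncard_sdiff_eq_ncard
      (↑(A ∪ B) : Set (Projectivization K (Fin (r + 1) → K))) T (Finset.finite_toSet _)
    have h2 := Finset.card_union_le A B
    rw [Set.ncard_coe_finset, Finset.coe_union] at h1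
    rw [Finset.coe_union]
    omega
  have hTc (p : Projectivization K (Fin (r + 1) → K)) (hp : p ∈ A ∪ B) (hpT : p ∉ T) :
      (if p ∈ A then a p else 0) = if p ∈ B then b p else 0 := by
    refine sub_eq_zero.mp (hT.coeff_eq_zero hZ
      (c := fun p => (if p ∈ A then a p else 0) - if p ∈ B then b p else 0) ?_ hp hpT)
    simp only [sub_smul, Finset.sum_sub_distrib, ite_smul, zero_smul, Finset.sum_ite_mem,
      Finset.union_inter_cancel_left, Finset.union_inter_cancel_right, ha, hb, sub_self]
  have hdiff : {p ∈ A | p ∉ T} = {p ∈ B | p ∉ T} := by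
    ext p
    simp only [Finset.mem_filter, and_congr_left_iff]
    intro hpT
    constructor
    · intro hp
      by_contra hpB
      have := hTc p (Finset.mem_union_left _ hp) hpT
      rw [if_pos hp, if_neg hpB] at this
      exact coeff_ne_zero_of_mem_decompSet hA ha hp this
    · intro hp
      by_contra hpA
      have := hTc p (Finset.mem_union_right _ hp) hpT
      rw [if_neg hpA, if_pos hp] at this
      exact coeff_ne_zero_of_mem_decompSet hB hb hp this.symm
  have hAT : (↑A : Set (Projectivization K (Fin (r + 1) → K))) ∩ T = ↑{p ∈ A | p ∈ T} := by
    ext; simp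
  have hBT : (↑B : Set (Projectivization K (Fin (r + 1) → K))) ∩ T = ↑{p ∈ B | p ∈ T} := by
    ext; simp
  have hAF : (↑A : Set (Projectivization K (Fin (r + 1) → K))) \ T = ↑{p ∈ A | p ∉ T} := by
    ext; simp
  have hBF : (↑B : Set (Projectivization K (Fin (r + 1) → K))) \ T = ↑{p ∈ B | p ∉ T} := by
    ext; simp
  have hcA := Finset.card_filter_add_card_filter_not (s := A) (· ∈ T)
  have hcB := Finset.card_filter_add_card_filter_not (s := B) (· ∈ T)
  have hcAB : {p ∈ A | p ∈ T}.card = {p ∈ B | p ∈ T}.card := by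
    have := congrArg Finset.card hdiff
    omega
  have hZT : ((↑A ∪ ↑B : Set (Projectivization K (Fin (r + 1) → K))) ∩ T).ncard ≤
      {p ∈ A | p ∈ T}.card + {p ∈ B | p ∈ T}.card := by
    rw [Set.union_inter_distrib_right, hAT, hBT]
    exact (Set.ncard_union_le _ _).trans (by simp only [Set.ncard_coe_finset, le_refl])
  set F := {p ∈ A | p ∉ T} with hF
  set f₁ := ∑ p ∈ F, a p • powForm K r d p with hf₁
  set g₀ := ∑ p ∈ A with p ∈ T, a p • powForm K r d p with hg₀
  have hfg : g₀ + f₁ = f := by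
    rw [← ha]; exact Finset.sum_filter_add_sum_filter_not A (· ∈ T) _
  have hf₁B : ∑ p ∈ B with p ∉ T, b p • powForm K r d p = f₁ := by
    rw [← hdiff]
    refine Finset.sum_congr rfl fun p hp => ?_
    have hpB : p ∈ B := (Finset.mem_filter.mp (hdiff ▸ hp)).1
    obtain ⟨hpA, hpT⟩ := Finset.mem_filter.mp hp
    have := hTc p (Finset.mem_union_left _ hpA) hpT
    rw [if_pos hpA, if_pos hpB] at this
    rw [this]
  have hg₀B : ∑ p ∈ B with p ∈ T, b p • powForm K r d p = g₀ := by
    have := Finset.sum_filter_add_sum_filter_not B (· ∈ T) fun p => b p • powForm K r d p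
    rw [hb, hf₁B, ← hfg] at this
    exact add_right_cancel this
  have hg₀A : g₀ ∈ decompSpan K r d ↑{p ∈ A | p ∈ T} := mem_decompSpan_finset.mpr ⟨a, rfl⟩
  have hf₁F : f₁ ∈ decompSpan K r d ↑F := mem_decompSpan_finset.mpr ⟨a, rfl⟩
  have hrank {g : MvPolynomial (Fin (r + 1)) K} {m : K} (hm : m • g = g₀)
      {E : Finset (Projectivization K (Fin (r + 1) → K))} (hE : g ∈ decompSpan K r d ↑E) :
      {p ∈ A | p ∈ T}.card ≤ E.card := by
    have hfE : f ∈ decompSpan K r d ↑(E ∪ F) := by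
      rw [← hfg, ← hm]
      refine add_mem (Submodule.smul_mem _ _ ?_) ?_
      · exact Submodule.span_mono (Set.image_mono (by simp)) hE
      · exact Submodule.span_mono (Set.image_mono (by simp)) hf₁F
    have h1 := symRank_le_card hfE
    have h2 := Finset.card_union_le E F
    omega
  have hg₀0 : g₀ ≠ 0 := by
    intro h0
    have := hrank (g := 0) (m := 1) (by simp [h0]) (E := ∅) (zero_mem _)
    simp only [Finset.card_empty] at this
    omega
  have hdisj : Disjoint (decompSpan K r d ↑{p ∈ A | p ∈ T}) (decompSpan K r d ↑F) := by
    rw [Submodule.disjoint_def]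
    intro x hx hxF
    obtain ⟨c, hc⟩ := mem_decompSpan_finset.mp hx
    obtain ⟨e, he⟩ := mem_decompSpan_finset.mp hxF
    have hZA : ((↑A : Set (Projectivization K (Fin (r + 1) → K))) \ T).ncard + 1 ≤ d := by
      refine le_trans (Nat.succ_le_succ (Set.ncard_le_ncard ?_ ?_)) hZ
      · exact Set.sdiff_subset_sdiff_left (by simp)
      · exact (Finset.finite_toSet _).sdiff
    rw [← he]
    refine Finset.sum_eq_zero fun p hp => ?_
    obtain ⟨hpA, hpT⟩ := Finset.mem_filter.mp hp
    have := hT.coeff_eq_zero hZA (c := fun p => if p ∈ T then c p else -e p) ?_ hpA hpT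
    · rw [if_neg hpT, neg_eq_zero] at this
      rw [this, zero_smul]
    · simp only [ite_smul, neg_smul]
      rw [Finset.sum_ite, hc, Finset.sum_neg_distrib, he, add_neg_cancel]
  have hspan : decompSpan K r d ↑{p ∈ A | p ∈ T} ⊓
      Submodule.span K ({f} ∪ powForm K r d '' ↑F) = K ∙ g₀ := by
    have h1 : Submodule.span K ({f} ∪ powForm K r d '' ↑F) = (K ∙ g₀) ⊔ decompSpan K r d ↑F := by
      rw [Submodule.span_union]
      refine le_antisymm (sup_le ?_ le_sup_right) (sup_le ?_ le_sup_right)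
      · rw [Submodule.span_singleton_le_iff_mem, ← hfg]
        exact Submodule.add_mem_sup (Submodule.mem_span_singleton_self _) hf₁F
      · rw [Submodule.span_singleton_le_iff_mem, eq_sub_of_add_eq hfg]
        exact sub_mem (Submodule.mem_sup_left (Submodule.mem_span_singleton_self _))
          (Submodule.mem_sup_right hf₁F)
    rw [h1, inf_comm, sup_inf_assoc_of_le _
      ((Submodule.span_singleton_le_iff_mem _ _).mpr hg₀A), inf_comm, hdisj.eq_bot, sup_bot_eq]
  rw [hAT, hBT, hAF, hBF, ← hdiff, hspan]
  refine ⟨rfl, finrank_span_singleton hg₀0, fun g hg hgm => ?_⟩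
  obtain ⟨m, rfl⟩ := Submodule.mem_span_singleton.mp hgm
  have hm : m ≠ 0 := by rintro rfl; simp at hg
  have hgA := Submodule.smul_mem _ m hg₀A
  have hgB : m • g₀ ∈ decompSpan K r d ↑{p ∈ B | p ∈ T} :=
    Submodule.smul_mem _ m (mem_decompSpan_finset.mpr ⟨b, hg₀B⟩)
  obtain ⟨E, hE, hgE⟩ := exists_card_eq_symRank hgA
  have h1 := hrank (inv_smul_smul₀ hm g₀) hgE
  have h2 := symRank_le_card hgA
  simp only [Set.ncard_coe_finset]
  exact ⟨by omega, hcAB, hgB, by omega⟩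
end
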